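/- Let β ∈ (1/2,1), ω = π/β, R > 0, and let f : ℝ₊ → [0,1] be C^{1,1} with f(r)=1 for 0<r≤R/3 and f(r)=0 for r≥2R/3. Set s(r,θ) = π^{-1/2} f(r) r^{β} sin(βθ) and σ(r,θ) = π^{-1/2} f(r) r^{-β} sin(βθ) on the wedge of radius R and angle ω. Then ∫_{W} (σ Δs − (Δσ) s) dx = -1, where the integration is over the annular region R/3 < r < 2R/3. -/

import Mathlib

open Real MeasureTheory Set

/-- Classical Laplacian of a function on `ℝ × ℝ`. -/
noncomputable def lap (u : ℝ × ℝ → ℝ) (x : ℝ × ℝ) : ℝ :=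
  fderiv ℝ (fun y => fderiv ℝ u y (1, 0)) x (1, 0) +
  fderiv ℝ (fun y => fderiv ℝ u y (0, 1)) x (0, 1)

/-- The open polar annular sector `{(r cos θ, r sin θ) : a < r < b, 0 < θ < ω}`. -/
def sector (a b ω : ℝ) : Set (ℝ × ℝ) :=
  (fun p : ℝ × ℝ => (p.1 * Real.cos p.2, p.1 * Real.sin p.2)) '' (Set.Ioo a b ×ˢ Set.Ioo 0 ω)


open Filter Topology

theorem HasFDerivAt.real_div {E : Type*} [NormedAddCommGroup E] [NormedSpace ℝ E]
    {f g : E → ℝ} {f' g' : E →L[ℝ] ℝ} {x : E} (hf : HasFDerivAt f f' x)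
    (hg : HasFDerivAt g g' x) (hx : g x ≠ 0) :
    HasFDerivAt (fun y => f y / g y) ((1 / g x) • f' - (f x / g x ^ 2) • g') x := by
  have h := hf.mul ((hasDerivAt_inv hx).comp_hasFDerivAt x hg)
  refine (h.congr_fderiv ?_).congr_of_eventuallyEq (.of_forall fun y => div_eq_mul_inv _ _)
  ext
  simp
  field_simp
  ring

theorem hasFDerivAt_sqrt_sq_add_sq {p : ℝ × ℝ} (hp : 0 < p.1 ^ 2 + p.2 ^ 2) :
    HasFDerivAt (fun q : ℝ × ℝ => √(q.1 ^ 2 + q.2 ^ 2))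
      ((p.1 / √(p.1 ^ 2 + p.2 ^ 2)) • ContinuousLinearMap.fst ℝ ℝ ℝ +
        (p.2 / √(p.1 ^ 2 + p.2 ^ 2)) • ContinuousLinearMap.snd ℝ ℝ ℝ) p := by
  have h := (((hasFDerivAt_fst (𝕜 := ℝ) (p := p)).pow 2).add
    ((hasFDerivAt_snd (𝕜 := ℝ) (p := p)).pow 2)).sqrt hp.ne'
  refine h.congr_fderiv ?_
  ext <;> simp <;> field_simp

/-- The branch of the polar angle that is close to `θ₀` on the half plane around direction `θ₀`. -/
noncomputable def angleNear (θ₀ : ℝ) (p : ℝ × ℝ) : ℝ :=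
  θ₀ + arctan ((p.2 * cos θ₀ - p.1 * sin θ₀) / (p.1 * cos θ₀ + p.2 * sin θ₀))

theorem sq_add_sq_rotate (θ₀ x y : ℝ) :
    (x * cos θ₀ + y * sin θ₀) ^ 2 + (y * cos θ₀ - x * sin θ₀) ^ 2 = x ^ 2 + y ^ 2 := by
  linear_combination (x ^ 2 + y ^ 2) * sin_sq_add_cos_sq θ₀

theorem hasFDerivAt_angleNear {θ₀ : ℝ} {p : ℝ × ℝ} (hp : 0 < p.1 * cos θ₀ + p.2 * sin θ₀) :
    HasFDerivAt (angleNear θ₀)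
      ((-p.2 / (p.1 ^ 2 + p.2 ^ 2)) • ContinuousLinearMap.fst ℝ ℝ ℝ +
        (p.1 / (p.1 ^ 2 + p.2 ^ 2)) • ContinuousLinearMap.snd ℝ ℝ ℝ) p := by
  have h1 := hasFDerivAt_fst (𝕜 := ℝ) (p := p)
  have h2 := hasFDerivAt_snd (𝕜 := ℝ) (p := p)
  have h := ((((h2.mul_const (cos θ₀)).sub (h1.mul_const (sin θ₀))).real_div
    ((h1.mul_const (cos θ₀)).add (h2.mul_const (sin θ₀))) hp.ne').arctan).const_add θ₀
  refine h.congr_fderiv ?_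
  have hrot := sq_add_sq_rotate θ₀ p.1 p.2
  have hcs := sin_sq_add_cos_sq θ₀
  have key : (1 : ℝ) + ((p.2 * cos θ₀ - p.1 * sin θ₀) / (p.1 * cos θ₀ + p.2 * sin θ₀)) ^ 2 =
      (p.1 ^ 2 + p.2 ^ 2) / (p.1 * cos θ₀ + p.2 * sin θ₀) ^ 2 := by
    rw [← hrot, add_div, div_self (by positivity), div_pow]
  have hpos : 0 < p.1 ^ 2 + p.2 ^ 2 := by rw [← hrot]; positivity
  ext
  · simp [key]
    field_simp
    linear_combination (-p.2) * hcs
  · simp [key]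
    field_simp
    linear_combination (p.1) * hcs

theorem sqrt_mul_cos_sin_angleNear {θ₀ : ℝ} {p : ℝ × ℝ}
    (hp : 0 < p.1 * cos θ₀ + p.2 * sin θ₀) :
    (√(p.1 ^ 2 + p.2 ^ 2) * cos (angleNear θ₀ p),
      √(p.1 ^ 2 + p.2 ^ 2) * sin (angleNear θ₀ p)) = p := by
  have hrot := sq_add_sq_rotate θ₀ p.1 p.2
  have hcs := sin_sq_add_cos_sq θ₀
  have hpos : 0 < p.1 ^ 2 + p.2 ^ 2 := by rw [← hrot]; positivity
  have key : √(1 + ((p.2 * cos θ₀ - p.1 * sin θ₀) / (p.1 * cos θ₀ + p.2 * sin θ₀)) ^ 2) =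
      √(p.1 ^ 2 + p.2 ^ 2) / (p.1 * cos θ₀ + p.2 * sin θ₀) := by
    rw [← sqrt_sq hp.le, ← sqrt_div hpos.le, sqrt_sq hp.le, ← hrot]
    congr 1
    rw [add_div, div_self (by positivity), div_pow]
  have hs : 0 < √(p.1 ^ 2 + p.2 ^ 2) := sqrt_pos.2 hpos
  ext
  · simp only [angleNear, cos_add, cos_arctan, sin_arctan, key]
    field_simp
    linear_combination (p.1) * hcs
  · simp only [angleNear, sin_add, cos_arctan, sin_arctan, key]
    field_simp
    linear_combination (p.2) * hcs

/-- The Laplacian of `F(r) sin(βθ)` in polar coordinates. -/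
theorem lap_eq_of_polar {β r₀ θ₀ F₂ : ℝ} {F F₁ : ℝ → ℝ} {u : ℝ × ℝ → ℝ} (hr₀ : 0 < r₀)
    (hF : ∀ᶠ r in 𝓝 r₀, HasDerivAt F (F₁ r) r) (hF₁ : HasDerivAt F₁ F₂ r₀)
    (hu : ∀ᶠ q in 𝓝 (r₀, θ₀), u (q.1 * cos q.2, q.1 * sin q.2) = F q.1 * sin (β * q.2)) :
    lap u (r₀ * cos θ₀, r₀ * sin θ₀) =
      (F₂ + F₁ r₀ / r₀ - β ^ 2 * F r₀ / r₀ ^ 2) * sin (β * θ₀) := by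
  set p₀ : ℝ × ℝ := (r₀ * cos θ₀, r₀ * sin θ₀) with hp₀
  have hcs := sin_sq_add_cos_sq θ₀
  have hX₀ : p₀.1 * cos θ₀ + p₀.2 * sin θ₀ = r₀ := by
    simp only [hp₀]; linear_combination r₀ * hcs
  have hsq₀ : p₀.1 ^ 2 + p₀.2 ^ 2 = r₀ ^ 2 := by
    simp only [hp₀]; linear_combination r₀ ^ 2 * hcs
  have hρ₀ : √(p₀.1 ^ 2 + p₀.2 ^ 2) = r₀ := by rw [hsq₀, sqrt_sq hr₀.le]
  have hA₀ : angleNear θ₀ p₀ = θ₀ := by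
    have : r₀ * sin θ₀ * cos θ₀ - r₀ * cos θ₀ * sin θ₀ = 0 := by ring
    simp [angleNear, hp₀, this]
  have hXpos : ∀ᶠ p in 𝓝 p₀, 0 < p.1 * cos θ₀ + p.2 * sin θ₀ := by
    have : ContinuousAt (fun p : ℝ × ℝ => p.1 * cos θ₀ + p.2 * sin θ₀) p₀ := by fun_prop
    exact this.eventually_const_lt (hr₀.trans_eq hX₀.symm)
  have hρt : Tendsto (fun p : ℝ × ℝ => √(p.1 ^ 2 + p.2 ^ 2)) (𝓝 p₀) (𝓝 r₀) := by
    have : ContinuousAt (fun p : ℝ × ℝ => √(p.1 ^ 2 + p.2 ^ 2)) p₀ := by fun_prop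
    simpa only [ContinuousAt, hρ₀] using this
  have hAt : Tendsto (angleNear θ₀) (𝓝 p₀) (𝓝 θ₀) := by
    have := (hasFDerivAt_angleNear (θ₀ := θ₀) (p := p₀) (by rw [hX₀]; exact hr₀)).continuousAt
    simpa only [ContinuousAt, hA₀] using this
  have hu' : ∀ᶠ p in 𝓝 p₀,
      u p = F √(p.1 ^ 2 + p.2 ^ 2) * sin (β * angleNear θ₀ p) := by
    filter_upwards [(hρt.prodMk_nhds hAt).eventually hu, hXpos] with p h hX
    simpa only [sqrt_mul_cos_sin_angleNear hX] using h
  have hgrad : ∀ᶠ p in 𝓝 p₀, HasFDerivAt u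
      ((F₁ √(p.1 ^ 2 + p.2 ^ 2) * (p.1 / √(p.1 ^ 2 + p.2 ^ 2)) * sin (β * angleNear θ₀ p) +
        F √(p.1 ^ 2 + p.2 ^ 2) * (cos (β * angleNear θ₀ p) * (β * (-p.2 / (p.1 ^ 2 + p.2 ^ 2)))))
          • ContinuousLinearMap.fst ℝ ℝ ℝ +
       (F₁ √(p.1 ^ 2 + p.2 ^ 2) * (p.2 / √(p.1 ^ 2 + p.2 ^ 2)) * sin (β * angleNear θ₀ p) +
        F √(p.1 ^ 2 + p.2 ^ 2) * (cos (β * angleNear θ₀ p) * (β * (p.1 / (p.1 ^ 2 + p.2 ^ 2)))))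
          • ContinuousLinearMap.snd ℝ ℝ ℝ) p := by
    filter_upwards [hu'.eventually_nhds, hXpos, hρt.eventually hF] with p hup hX hFp
    have hpos : 0 < p.1 ^ 2 + p.2 ^ 2 := by
      rw [← sq_add_sq_rotate θ₀ p.1 p.2]; positivity
    have h := (hFp.comp_hasFDerivAt p (hasFDerivAt_sqrt_sq_add_sq hpos)).mul
      (((hasFDerivAt_angleNear hX).const_mul β).sin)
    refine (h.congr_of_eventuallyEq hup).congr_fderiv ?_
    ext <;> simp <;> ring
  have hX₀' : 0 < p₀.1 * cos θ₀ + p₀.2 * sin θ₀ := by rw [hX₀]; exact hr₀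
  have hpos₀ : 0 < p₀.1 ^ 2 + p₀.2 ^ 2 := by rw [hsq₀]; positivity
  have dρ := hasFDerivAt_sqrt_sq_add_sq hpos₀
  have dA := (hasFDerivAt_angleNear hX₀').const_mul β
  have d1 := hasFDerivAt_fst (𝕜 := ℝ) (p := p₀)
  have d2 := hasFDerivAt_snd (𝕜 := ℝ) (p := p₀)
  have dsq := (d1.pow 2).add (d2.pow 2)
  have dF := HasDerivAt.comp_hasFDerivAt (h₂ := F) p₀ (by rw [hρ₀]; exact hF.self_of_nhds) dρ
  have dF₁ := HasDerivAt.comp_hasFDerivAt (h₂ := F₁) p₀ (by rw [hρ₀]; exact hF₁) dρ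
  have hρne : √(p₀.1 ^ 2 + p₀.2 ^ 2) ≠ 0 := by rw [hρ₀]; exact hr₀.ne'
  have hxx := ((dF₁.mul (d1.real_div dρ hρne)).mul dA.sin).add
    (dF.mul (dA.cos.mul ((d2.neg.real_div dsq hpos₀.ne').const_mul β)))
  have hyy := ((dF₁.mul (d2.real_div dρ hρne)).mul dA.sin).add
    (dF.mul (dA.cos.mul ((d1.real_div dsq hpos₀.ne').const_mul β)))
  have ex := hxx.congr_of_eventuallyEq (f₁ := fun y => fderiv ℝ u y (1, 0)) (by
    filter_upwards [hgrad] with p hp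
    rw [hp.fderiv]; simp)
  have ey := hyy.congr_of_eventuallyEq (f₁ := fun y => fderiv ℝ u y (0, 1)) (by
    filter_upwards [hgrad] with p hp
    rw [hp.fderiv]; simp)
  rw [lap, ex.fderiv, ey.fderiv]
  clear_value p₀
  simp [hρ₀, hA₀]
  have hx := eq_sub_of_add_eq hsq₀
  simp only [hsq₀]
  field_simp
  simp only [hx]
  linear_combination (-(β ^ 2 * sin (β * θ₀) * F r₀)) * hsq₀

/-- The Laplacian of `c f(r) r^γ sin(βθ)` when `r^γ sin(βθ)` is harmonic. -/
theorem lap_eq_of_polar_rpow {β γ c r₀ θ₀ : ℝ} {f : ℝ → ℝ} {u : ℝ × ℝ → ℝ} (hγ : γ ^ 2 = β ^ 2)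
    (hr₀ : 0 < r₀) (hf : Differentiable ℝ f) (hf' : DifferentiableAt ℝ (deriv f) r₀)
    (hu : ∀ᶠ q in 𝓝 (r₀, θ₀),
      u (q.1 * cos q.2, q.1 * sin q.2) = c * f q.1 * q.1 ^ γ * sin (β * q.2)) :
    lap u (r₀ * cos θ₀, r₀ * sin θ₀) =
      c * (deriv (deriv f) r₀ + (1 + 2 * γ) * deriv f r₀ / r₀) * r₀ ^ γ * sin (β * θ₀) := by
  have hpow (δ r : ℝ) (hr : 0 < r) : HasDerivAt (fun x : ℝ => x ^ δ) (δ * r ^ (δ - 1)) r :=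
    Real.hasDerivAt_rpow_const (Or.inl hr.ne')
  have hF : ∀ᶠ r in 𝓝 r₀, HasDerivAt (fun r => c * f r * r ^ γ)
      (c * deriv f r * r ^ γ + c * f r * (γ * r ^ (γ - 1))) r := by
    filter_upwards [lt_mem_nhds hr₀] with r hr
    exact ((hf r).hasDerivAt.const_mul c).mul (hpow γ r hr)
  have hF₁ := ((hf'.hasDerivAt.const_mul c).mul (hpow γ r₀ hr₀)).add
    (((hf r₀).hasDerivAt.const_mul c).mul ((hpow (γ - 1) r₀ hr₀).const_mul γ))
  rw [lap_eq_of_polar hr₀ hF hF₁ hu]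
  rw [show r₀ ^ (γ - 1 - 1) = r₀ ^ γ / r₀ ^ 2 by
    rw [rpow_sub_one hr₀.ne', rpow_sub_one hr₀.ne']; field_simp, rpow_sub_one hr₀.ne', ← hγ]
  field_simp
  ring

theorem injOn_polar {a b ω : ℝ} (ha : 0 ≤ a) (hω : ω ≤ 2 * π) :
    InjOn (fun p : ℝ × ℝ => (p.1 * Real.cos p.2, p.1 * Real.sin p.2)) (Ioo a b ×ˢ Ioo 0 ω) := by
  rintro ⟨r, θ⟩ ⟨hr, hθ⟩ ⟨r', θ'⟩ ⟨hr', hθ'⟩ h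
  simp only [mem_Ioo, Prod.mk.injEq] at hr hθ hr' hθ' h
  have h0 : 0 < r := ha.trans_lt hr.1
  have h0' : 0 < r' := ha.trans_lt hr'.1
  have hrr : r = r' := by
    rw [← sq_eq_sq₀ h0.le h0'.le]
    linear_combination (r * cos θ + r' * cos θ') * h.1 + (r * sin θ + r' * sin θ') * h.2 -
      r ^ 2 * sin_sq_add_cos_sq θ + r' ^ 2 * sin_sq_add_cos_sq θ'
  subst hrr
  have hc := mul_left_cancel₀ h0.ne' h.1
  have hs := mul_left_cancel₀ h0.ne' h.2
  have : cos (θ - θ') = 1 := by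
    rw [cos_sub, hc, hs]; linear_combination sin_sq_add_cos_sq θ'
  rw [cos_eq_one_iff_of_lt_of_lt (by linarith) (by linarith)] at this
  rw [sub_eq_zero.1 this]

theorem integral_sector {a b ω : ℝ} (ha : 0 ≤ a) (hω : ω ≤ 2 * π) (g : ℝ × ℝ → ℝ) :
    ∫ x in sector a b ω, g x =
      ∫ p in Ioo a b ×ˢ Ioo 0 ω, p.1 * g (p.1 * cos p.2, p.1 * sin p.2) := by
  rw [sector, integral_image_eq_integral_abs_det_fderiv_smul volume
    (f := fun p : ℝ × ℝ => (p.1 * cos p.2, p.1 * sin p.2)) (f' := fderivPolarCoordSymm)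
    (measurableSet_Ioo.prod measurableSet_Ioo)
    (fun p _ => (hasFDerivAt_polarCoord_symm p).hasFDerivWithinAt) (injOn_polar ha hω)]
  refine setIntegral_congr_fun (measurableSet_Ioo.prod measurableSet_Ioo) fun p hp => ?_
  simp only [det_fderivPolarCoordSymm, abs_of_pos (ha.trans_lt hp.1.1), smul_eq_mul]

theorem integral_mul_deriv_self {f : ℝ → ℝ} (hf : ContDiff ℝ 1 f) {a b : ℝ} (hab : a ≤ b) :
    ∫ r in Ioo a b, f r * deriv f r = (f b ^ 2 - f a ^ 2) / 2 := by
  have hd : Differentiable ℝ f := hf.differentiable one_ne_zero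
  have hc : Continuous (deriv f) := hf.continuous_deriv le_rfl
  rw [← integral_Ioc_eq_integral_Ioo, ← intervalIntegral.integral_of_le hab,
    intervalIntegral.integral_eq_sub_of_hasDerivAt (f := fun r => f r ^ 2 / 2)]
  · ring
  · intro r _
    exact (((hd r).hasDerivAt.pow 2).div_const 2).congr_deriv (by simp; ring)
  · exact (hd.continuous.mul hc).intervalIntegrable _ _

theorem integral_sin_mul_sq {β : ℝ} (hβ : 0 < β) :
    ∫ θ in Ioo 0 (π / β), sin (β * θ) ^ 2 = π / β / 2 := by
  rw [← integral_Ioc_eq_integral_Ioo, ← intervalIntegral.integral_of_le (by positivity),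
    intervalIntegral.integral_comp_mul_left (fun x => sin x ^ 2) hβ.ne', integral_sin_sq,
    mul_div_cancel₀ _ hβ.ne']
  simp
  ring

/-- With `s(r,θ) = π^{-1/2} f(r) r^β sin(βθ)` and `σ(r,θ) = π^{-1/2} f(r) r^{-β} sin(βθ)`,
`f` a `C^{1,1}` cutoff equal to `1` on `(0,R/3]` and `0` on `[2R/3,∞)`, one has
`∫ (σ Δs − (Δσ) s) = −1` over the annular region `R/3 < r < 2R/3`, `0 < θ < ω`. -/
theorem stmt3 (β ω R : ℝ) (hβ : β ∈ Set.Ioo (1/2 : ℝ) 1) (hω : ω = π / β) (hR : 0 < R)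
    (f : ℝ → ℝ) (hf : ContDiff ℝ 1 f) (hfLip : ∃ L, LipschitzWith L (deriv f))
    (hf01 : ∀ r : ℝ, f r ∈ Set.Icc (0:ℝ) 1)
    (hf1 : ∀ r : ℝ, 0 < r → r ≤ R / 3 → f r = 1)
    (hf0 : ∀ r : ℝ, 2 * R / 3 ≤ r → f r = 0)
    (s σ : ℝ × ℝ → ℝ)
    (hs : ∀ r θ : ℝ, 0 < r → r < R → 0 < θ → θ < ω →
      s (r * Real.cos θ, r * Real.sin θ) = π ^ (-(1:ℝ)/2) * f r * r ^ β * Real.sin (β * θ))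
    (hσ : ∀ r θ : ℝ, 0 < r → r < R → 0 < θ → θ < ω →
      σ (r * Real.cos θ, r * Real.sin θ) = π ^ (-(1:ℝ)/2) * f r * r ^ (-β) * Real.sin (β * θ)) :
    ∫ x in sector (R/3) (2*R/3) ω, (σ x * lap s x - lap σ x * s x) = -1 := by
  obtain ⟨hβ₁, hβ₂⟩ := hβ
  have hβ₀ : 0 < β := by linarith
  have hω₂ : ω ≤ 2 * π := by
    rw [hω, div_le_iff₀ hβ₀]; nlinarith [pi_pos]
  obtain ⟨L, hL⟩ := hfLip
  have hd : Differentiable ℝ f := hf.differentiable one_ne_zero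
  rw [integral_sector (by positivity) hω₂]
  have hae : ∀ᵐ p : ℝ × ℝ, DifferentiableAt ℝ (deriv f) p.1 :=
    Measure.quasiMeasurePreserving_fst.ae hL.ae_differentiableAt_real
  have hc : (π ^ (-(1 : ℝ) / 2)) ^ 2 = π⁻¹ := by
    rw [← rpow_natCast, ← rpow_mul pi_pos.le, ← rpow_neg_one]; norm_num
  have hcongr : ∀ᵐ p : ℝ × ℝ, p ∈ Ioo (R / 3) (2 * R / 3) ×ˢ Ioo 0 ω →
      p.1 * (σ (p.1 * cos p.2, p.1 * sin p.2) * lap s (p.1 * cos p.2, p.1 * sin p.2) -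
        lap σ (p.1 * cos p.2, p.1 * sin p.2) * s (p.1 * cos p.2, p.1 * sin p.2)) =
      (f p.1 * deriv f p.1) * (4 * β / π * sin (β * p.2) ^ 2) := by
    filter_upwards [hae] with p hp ⟨⟨hr₁, hr₂⟩, hθ₁, hθ₂⟩
    have hr₀ : 0 < p.1 := by linarith
    have hrR : p.1 < R := by linarith
    have hmem : ∀ᶠ q in 𝓝 (p.1, p.2), q ∈ Ioo 0 R ×ˢ Ioo 0 ω :=
      (isOpen_Ioo.prod isOpen_Ioo).mem_nhds ⟨⟨hr₀, hrR⟩, hθ₁, hθ₂⟩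
    rw [lap_eq_of_polar_rpow rfl hr₀ hd hp
        (hmem.mono fun q hq => hs q.1 q.2 hq.1.1 hq.1.2 hq.2.1 hq.2.2),
      lap_eq_of_polar_rpow (neg_sq β) hr₀ hd hp
        (hmem.mono fun q hq => hσ q.1 q.2 hq.1.1 hq.1.2 hq.2.1 hq.2.2),
      hs _ _ hr₀ hrR hθ₁ hθ₂, hσ _ _ hr₀ hrR hθ₁ hθ₂, rpow_neg hr₀.le, div_eq_mul_inv _ π, ← hc]
    have := rpow_pos_of_pos hr₀ β
    field_simp
    ring
  rw [setIntegral_congr_ae (measurableSet_Ioo.prod measurableSet_Ioo) hcongr,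
    Measure.volume_eq_prod,
    setIntegral_prod_mul (fun r => f r * deriv f r) (fun θ => 4 * β / π * sin (β * θ) ^ 2),
    integral_mul_deriv_self hf (by linarith), integral_const_mul, hω, integral_sin_mul_sq hβ₀,
    hf0 _ le_rfl, hf1 _ (by positivity) le_rfl]
  field_simp
  norm_num
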